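/- arXiv:2012.11561 — 7 statements merged into one kernel-verified Lean document; each statement's English description precedes it below -/
import Mathlib

section
/- For every t > 0, the modified Bessel functions of the second kind satisfy K₀(t) ≤ K₁(t) ≤ (1 + 1/(2t))·K₀(t); equivalently, 1 ≤ K₁(t)/K₀(t) ≤ 1 + 1/(2t). -/
/-- Modified Bessel function of the second kind, order 0. -/
noncomputable def K0 (x : ℝ) : ℝ := ∫ t in Set.Ioi (0:ℝ), Real.exp (-x * Real.cosh t)

/-- Modified Bessel function of the second kind, order 1. -/
noncomputable def K1 (x : ℝ) : ℝ := ∫ t in Set.Ioi (0:ℝ), Real.exp (-x * Real.cosh t) * Real.cosh t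

open Real Set Filter Topology MeasureTheory in
theorem tendsto_exp_neg_mul_cosh_atTop {x : ℝ} (hx : 0 < x) :
    Tendsto (fun t => exp (-x * cosh t)) atTop (𝓝 0) := by
  refine tendsto_exp_atBot.comp (Tendsto.const_mul_atTop_of_neg (neg_lt_zero.2 hx) ?_)
  refine tendsto_atTop_mono (fun t => ?_) (tendsto_exp_atTop.atTop_div_const (two_pos (α := ℝ)))
  rw [cosh_eq]
  linarith [exp_pos (-t)]

open Real in
theorem hasDerivAt_exp_neg_mul_cosh (x t : ℝ) :
    HasDerivAt (fun t => exp (-x * cosh t)) (exp (-x * cosh t) * (-x * sinh t)) t :=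
  ((hasDerivAt_cosh t).const_mul (-x)).exp

open Real Set Filter Topology MeasureTheory in
theorem integrableOn_exp_neg_mul_cosh_mul_cosh {x : ℝ} (hx : 0 < x) :
    IntegrableOn (fun t => exp (-x * cosh t) * cosh t) (Ioi 0) := by
  have hsinh : IntegrableOn (fun t => exp (-x * cosh t) * (-x * sinh t)) (Ioi 0) :=
    integrableOn_Ioi_deriv_of_nonpos' (fun t _ => hasDerivAt_exp_neg_mul_cosh x t)
      (fun t ht => mul_nonpos_of_nonneg_of_nonpos (exp_pos _).le
        (mul_nonpos_of_nonpos_of_nonneg (neg_nonpos.2 hx.le) (sinh_nonneg_iff.2 (le_of_lt ht))))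
      (tendsto_exp_neg_mul_cosh_atTop hx)
  have hexp : IntegrableOn (fun t => exp (-x * cosh t) * exp (-t)) (Ioi 0) := by
    refine (integrableOn_exp_neg_Ioi 0).mono' (by fun_prop) (ae_of_all _ fun t => ?_)
    rw [norm_of_nonneg (by positivity)]
    refine mul_le_of_le_one_left (exp_pos _).le (exp_le_one_iff.2 ?_)
    nlinarith [cosh_pos t]
  refine ((hsinh.const_mul (-x⁻¹)).add hexp).congr (ae_of_all _ fun t => ?_)
  simp only [Pi.add_apply]
  rw [← cosh_sub_sinh]
  field_simp
  ring

open Real Set Filter Topology MeasureTheory in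
theorem integrableOn_exp_neg_mul_cosh {x : ℝ} (hx : 0 < x) :
    IntegrableOn (fun t => exp (-x * cosh t)) (Ioi 0) := by
  refine (integrableOn_exp_neg_mul_cosh_mul_cosh hx).mono' (by fun_prop) (ae_of_all _ fun t => ?_)
  rw [norm_of_nonneg (exp_pos _).le]
  exact le_mul_of_one_le_right (exp_pos _).le (one_le_cosh t)

open Real in
/-- The function `sinh t / (1 + cosh t)` is `tanh (t / 2)`. -/
theorem hasDerivAt_sinh_div_one_add_cosh (t : ℝ) :
    HasDerivAt (fun t => sinh t / (1 + cosh t)) (1 / (1 + cosh t)) t := by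
  have h : 1 + cosh t ≠ 0 := by linarith [cosh_pos t]
  refine ((hasDerivAt_sinh t).div ((hasDerivAt_cosh t).const_add 1) h).congr_deriv ?_
  field_simp
  linarith [cosh_sq t]

open Real Set Filter Topology MeasureTheory in
theorem integral_exp_neg_mul_cosh_mul_cosh_sub_one {x : ℝ} (hx : 0 < x) :
    x * ∫ t in Ioi (0 : ℝ), exp (-x * cosh t) * (cosh t - 1) =
      ∫ t in Ioi (0 : ℝ), exp (-x * cosh t) * (1 / (1 + cosh t)) := by
  have hcosh : IntegrableOn (fun t => exp (-x * cosh t) * (cosh t - 1)) (Ioi 0) := by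
    simp only [mul_sub, mul_one]
    exact (integrableOn_exp_neg_mul_cosh_mul_cosh hx).sub (integrableOn_exp_neg_mul_cosh hx)
  have hinv : IntegrableOn (fun t => exp (-x * cosh t) * (1 / (1 + cosh t))) (Ioi 0) := by
    refine (integrableOn_exp_neg_mul_cosh hx).mono'
      (Measurable.aestronglyMeasurable (by fun_prop)) (ae_of_all _ fun t => ?_)
    have h := cosh_pos t
    rw [norm_of_nonneg (by positivity)]
    refine mul_le_of_le_one_right (exp_pos _).le ((div_le_one (by positivity)).2 ?_)
    linarith
  have hlim : Tendsto (fun t => exp (-x * cosh t) * (sinh t / (1 + cosh t))) atTop (𝓝 0) := by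
    refine squeeze_zero' ?_ ?_ (tendsto_exp_neg_mul_cosh_atTop hx)
    · filter_upwards [eventually_ge_atTop 0] with t ht
      have h := cosh_pos t
      have h' := sinh_nonneg_iff.2 ht
      positivity
    · refine Eventually.of_forall fun t => mul_le_of_le_one_right (exp_pos _).le ?_
      have h := cosh_pos t
      refine (div_le_one (by positivity)).2 ?_
      linarith [sinh_lt_cosh t]
  have hderiv (t : ℝ) : HasDerivAt (fun t => exp (-x * cosh t) * (sinh t / (1 + cosh t)))
      (exp (-x * cosh t) * (1 / (1 + cosh t)) - x * (exp (-x * cosh t) * (cosh t - 1))) t := by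
    have h : 1 + cosh t ≠ 0 := by linarith [cosh_pos t]
    refine ((hasDerivAt_exp_neg_mul_cosh x t).mul
      (hasDerivAt_sinh_div_one_add_cosh t)).congr_deriv ?_
    field_simp
    linear_combination x * cosh_sq t
  have hint := integral_Ioi_of_hasDerivAt_of_tendsto' (fun t _ => hderiv t)
    (hinv.sub (hcosh.const_mul x)) hlim
  rw [integral_sub hinv (hcosh.const_mul x), integral_const_mul] at hint
  simp only [sinh_zero, zero_div, mul_zero, sub_zero] at hint
  linarith

open Real Set MeasureTheory in
theorem K1_sub_K0 {x : ℝ} (hx : 0 < x) :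
    K1 x - K0 x = ∫ t in Ioi (0 : ℝ), exp (-x * cosh t) * (cosh t - 1) := by
  simp only [K0, K1, mul_sub, mul_one]
  exact (integral_sub (integrableOn_exp_neg_mul_cosh_mul_cosh hx)
    (integrableOn_exp_neg_mul_cosh hx)).symm

open Real Set Filter MeasureTheory in
theorem two_mul_integral_exp_neg_mul_cosh_div_le_K0 {x : ℝ} (hx : 0 < x) :
    2 * ∫ t in Ioi (0 : ℝ), exp (-x * cosh t) * (1 / (1 + cosh t)) ≤ K0 x := by
  rw [← integral_const_mul]
  refine integral_mono_of_nonneg (ae_of_all _ fun t => ?_) (integrableOn_exp_neg_mul_cosh hx)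
    (ae_of_all _ fun t => ?_)
  · have h := cosh_pos t
    simp only [Pi.zero_apply]
    positivity
  · have h := one_le_cosh t
    have h' : 2 * (1 / (1 + cosh t)) ≤ 1 := by
      rw [mul_one_div]
      exact (div_le_one (by positivity)).2 (by linarith)
    calc 2 * (exp (-x * cosh t) * (1 / (1 + cosh t)))
        = exp (-x * cosh t) * (2 * (1 / (1 + cosh t))) := by ring
      _ ≤ exp (-x * cosh t) := mul_le_of_le_one_right (exp_pos _).le h'

theorem bessel_ratio_bounds (t : ℝ) (ht : 0 < t) :
    K0 t ≤ K1 t ∧ K1 t ≤ (1 + 1/(2*t)) * K0 t := by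
  have hsub := K1_sub_K0 ht
  constructor
  · rw [← sub_nonneg, hsub]
    exact MeasureTheory.integral_nonneg fun s =>
      mul_nonneg (Real.exp_pos _).le (sub_nonneg.2 (Real.one_le_cosh s))
  · have hle := two_mul_integral_exp_neg_mul_cosh_div_le_K0 ht
    rw [← integral_exp_neg_mul_cosh_mul_cosh_sub_one ht, ← hsub] at hle
    have h : K1 t - K0 t ≤ K0 t / (2 * t) := by
      rw [le_div_iff₀ (by positivity)]
      linarith
    calc K1 t ≤ K0 t + K0 t / (2 * t) := by linarith
      _ = (1 + 1/(2*t)) * K0 t := by ring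
end

section
/- For every t > 0, (2 + t²)·K₀(t) − 2t·K₁(t) ≥ 0. -/
open MeasureTheory Filter Topology Set

theorem Real.tendsto_cosh_atTop : Tendsto Real.cosh atTop atTop := by
  refine tendsto_atTop_mono' atTop ?_ tendsto_id
  filter_upwards [eventually_ge_atTop 0] with u hu
  exact (Real.self_le_sinh_iff.2 hu).trans (Real.sinh_lt_cosh u).le

theorem tendsto_exp_neg_mul_cosh {t : ℝ} (ht : 0 < t) :
    Tendsto (fun u ↦ Real.exp (-t * Real.cosh u)) atTop (𝓝 0) :=
  Real.tendsto_exp_atBot.comp (Real.tendsto_cosh_atTop.const_mul_atTop_of_neg (neg_lt_zero.2 ht))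

theorem hasDerivAt_exp_neg_mul_cosh_s3 (t u : ℝ) :
    HasDerivAt (fun u ↦ Real.exp (-t * Real.cosh u))
      (Real.exp (-t * Real.cosh u) * (-t * Real.sinh u)) u :=
  ((Real.hasDerivAt_cosh u).const_mul (-t)).exp

theorem integrableOn_exp_neg_mul_cosh_s3 {t : ℝ} (ht : 0 < t) :
    IntegrableOn (fun u ↦ Real.exp (-t * Real.cosh u)) (Ioi 0) := by
  refine (exp_neg_integrableOn_Ioi 0 ht).mono' (by fun_prop) ?_
  filter_upwards [ae_restrict_mem measurableSet_Ioi] with u hu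
  have h : u ≤ Real.cosh u :=
    (Real.self_le_sinh_iff.2 (mem_Ioi.1 hu).le).trans (Real.sinh_lt_cosh u).le
  rw [Real.norm_of_nonneg (Real.exp_pos _).le]
  exact Real.exp_le_exp.2 (by nlinarith)

theorem integrableOn_exp_neg_mul_cosh_mul_sinh {t : ℝ} (ht : 0 < t) :
    IntegrableOn (fun u ↦ Real.exp (-t * Real.cosh u) * Real.sinh u) (Ioi 0) := by
  refine integrableOn_Ioi_deriv_of_nonneg' (g := fun u ↦ -t⁻¹ * Real.exp (-t * Real.cosh u))
    (l := -t⁻¹ * 0) (fun u _ ↦ ?_) (fun u hu ↦ ?_) ((tendsto_exp_neg_mul_cosh ht).const_mul _)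
  · refine ((hasDerivAt_exp_neg_mul_cosh_s3 t u).const_mul (-t⁻¹)).congr_deriv ?_
    field_simp
  · exact mul_nonneg (Real.exp_pos _).le (Real.sinh_nonneg_iff.2 (mem_Ioi.1 hu).le)

theorem integrableOn_exp_neg_mul_cosh_mul_cosh_s3 {t : ℝ} (ht : 0 < t) :
    IntegrableOn (fun u ↦ Real.exp (-t * Real.cosh u) * Real.cosh u) (Ioi 0) := by
  refine ((integrableOn_exp_neg_mul_cosh_mul_sinh ht).add
    (integrableOn_exp_neg_mul_cosh_s3 ht)).mono' (by fun_prop) ?_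
  filter_upwards [ae_restrict_mem measurableSet_Ioi] with u hu
  have h : Real.cosh u ≤ Real.sinh u + 1 := by
    have := Real.cosh_sub_sinh u
    have : Real.exp (-u) ≤ 1 := Real.exp_le_one_iff.2 (neg_nonpos.2 (mem_Ioi.1 hu).le)
    linarith
  rw [Real.norm_of_nonneg (mul_pos (Real.exp_pos _) (Real.cosh_pos u)).le]
  simp only [Pi.add_apply]
  nlinarith [Real.exp_pos (-t * Real.cosh u)]

/-- The half-angle function `sinh u / (1 + cosh u) = tanh (u / 2)`. -/
theorem hasDerivAt_sinh_div_one_add_cosh_s3 (u : ℝ) :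
    HasDerivAt (fun u ↦ Real.sinh u / (1 + Real.cosh u)) (1 / (1 + Real.cosh u)) u := by
  have h : 1 + Real.cosh u ≠ 0 := by linarith [Real.cosh_pos u]
  refine ((Real.hasDerivAt_sinh u).div ((Real.hasDerivAt_cosh u).const_add 1) h).congr_deriv ?_
  field_simp
  linarith [Real.cosh_sq u]

theorem abs_sinh_div_one_add_cosh_le_one (u : ℝ) :
    |Real.sinh u / (1 + Real.cosh u)| ≤ 1 := by
  have h : 0 < 1 + Real.cosh u := by linarith [Real.cosh_pos u]
  rw [abs_div, abs_of_pos h, div_le_one h]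
  exact abs_le_of_sq_le_sq (by nlinarith [Real.cosh_sq u, Real.cosh_pos u]) h.le

/-- The bound `K₁(t) / K₀(t) ≤ 1 + 1 / (2t)`, from integrating the derivative of
`-2 exp (-t cosh u) tanh (u / 2)` over the half-line. -/
theorem two_mul_mul_K1_le {t : ℝ} (ht : 0 < t) : 2 * t * K1 t ≤ (2 * t + 1) * K0 t := by
  have h0 := integrableOn_exp_neg_mul_cosh_s3 ht
  have h1 := integrableOn_exp_neg_mul_cosh_mul_cosh_s3 ht
  have hw : IntegrableOn
      (fun u ↦ Real.exp (-t * Real.cosh u) * (2 / (1 + Real.cosh u))) (Ioi 0) := by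
    have hm : Measurable fun u ↦ Real.exp (-t * Real.cosh u) * (2 / (1 + Real.cosh u)) := by
      fun_prop
    refine h0.mono' hm.aestronglyMeasurable (ae_of_all _ fun u ↦ ?_)
    have hc := Real.one_le_cosh u
    rw [Real.norm_of_nonneg (by positivity)]
    exact mul_le_of_le_one_right (Real.exp_pos _).le ((div_le_one (by linarith)).2 (by linarith))
  have hw_le : ∫ u in Ioi (0 : ℝ), Real.exp (-t * Real.cosh u) * (2 / (1 + Real.cosh u)) ≤ K0 t := by
    refine integral_mono hw h0 fun u ↦ ?_
    have hc := Real.one_le_cosh u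
    exact mul_le_of_le_one_right (Real.exp_pos _).le ((div_le_one (by linarith)).2 (by linarith))
  have hderiv (u : ℝ) : HasDerivAt
      (fun u ↦ Real.exp (-t * Real.cosh u) * (Real.sinh u / (1 + Real.cosh u)) * 2)
      (Real.exp (-t * Real.cosh u) * (2 / (1 + Real.cosh u)) -
        (2 * t * (Real.exp (-t * Real.cosh u) * Real.cosh u) -
          2 * t * Real.exp (-t * Real.cosh u))) u := by
    refine (((hasDerivAt_exp_neg_mul_cosh_s3 t u).mul
      (hasDerivAt_sinh_div_one_add_cosh_s3 u)).mul_const 2).congr_deriv ?_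
    have h : 1 + Real.cosh u ≠ 0 := by linarith [Real.cosh_pos u]
    field_simp
    linear_combination t * Real.cosh_sq u
  have hlim : Tendsto
      (fun u ↦ Real.exp (-t * Real.cosh u) * (Real.sinh u / (1 + Real.cosh u)) * 2) atTop (𝓝 0) := by
    have h := (tendsto_exp_neg_mul_cosh ht).zero_mul_isBoundedUnder_le
      (g := fun u ↦ Real.sinh u / (1 + Real.cosh u))
      (isBoundedUnder_of ⟨1, fun u ↦ abs_sinh_div_one_add_cosh_le_one u⟩)
    simpa using h.mul_const 2
  have hd : IntegrableOn (fun u ↦ 2 * t * (Real.exp (-t * Real.cosh u) * Real.cosh u) -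
      2 * t * Real.exp (-t * Real.cosh u)) (Ioi 0) :=
    (h1.const_mul (2 * t)).sub (h0.const_mul (2 * t))
  have key := integral_Ioi_of_hasDerivAt_of_tendsto' (a := 0) (fun u _ ↦ hderiv u) (hw.sub hd) hlim
  rw [integral_sub hw hd,
    integral_sub (h1.const_mul (2 * t)) (h0.const_mul (2 * t)),
    integral_const_mul, integral_const_mul] at key
  change _ - (2 * t * K1 t - 2 * t * K0 t) = _ at key
  simp only [Real.sinh_zero, zero_div, mul_zero, zero_mul, sub_zero] at key
  linarith

theorem K0_nonneg (t : ℝ) : 0 ≤ K0 t :=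
  integral_nonneg fun _ ↦ (Real.exp_pos _).le

theorem bessel_combination_nonneg (t : ℝ) (ht : 0 < t) :
    (2 + t^2) * K0 t - 2*t*K1 t ≥ 0 := by
  nlinarith [two_mul_mul_K1_le ht, mul_nonneg (sq_nonneg (t - 1)) (K0_nonneg t)]
end

section
/- For every ε > 0 and every real k ≠ 0, ∫_{−∞}^{∞} cos(kx)/(x² + ε²)^{3/2} dx = (2|k|/ε)·K₁(ε|k|). -/
open MeasureTheory Set

theorem integral_cos_mul_exp_neg_mul_sq (k : ℝ) {s : ℝ} (hs : 0 < s) :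
    ∫ x : ℝ, Real.cos (k * x) * Real.exp (-s * x ^ 2) =
      √(Real.pi / s) * Real.exp (-k ^ 2 / (4 * s)) := by
  have hsc : 0 < (s : ℂ).re := by simpa using hs
  have h := congrArg Complex.re (fourierIntegral_gaussian hsc (k : ℂ))
  have hpt (x : ℝ) : (Complex.exp (Complex.I * k * x) * Complex.exp (-s * (x : ℂ) ^ 2)).re =
      Real.cos (k * x) * Real.exp (-s * x ^ 2) := by
    have h1 : Complex.I * k * x = ((k * x : ℝ) : ℂ) * Complex.I := by push_cast; ring
    have h2 : -(s : ℂ) * (x : ℂ) ^ 2 = ((-s * x ^ 2 : ℝ) : ℂ) := by push_cast; ring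
    rw [h1, h2, ← Complex.ofReal_exp, Complex.re_mul_ofReal, Complex.exp_ofReal_mul_I_re]
  have h_int : Integrable fun x : ℝ =>
      Complex.exp (Complex.I * k * x) * Complex.exp (-s * (x : ℂ) ^ 2) := by
    refine (GaussianFourier.integrable_cexp_neg_mul_sq_add_real_mul_I hsc 0).bdd_mul
      (f := fun x : ℝ => Complex.exp (Complex.I * k * x)) (c := 1)
      (by fun_prop) (Filter.Eventually.of_forall fun x => ?_) |>.congr ?_
    · rw [show Complex.I * k * x = ((k * x : ℝ) : ℂ) * Complex.I by push_cast; ring,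
        Complex.norm_exp_ofReal_mul_I]
    · exact Filter.Eventually.of_forall fun x => by simp
  have hre : (∫ x : ℝ, Complex.exp (Complex.I * k * x) * Complex.exp (-s * (x : ℂ) ^ 2)).re =
      ∫ x : ℝ, (Complex.exp (Complex.I * k * x) * Complex.exp (-s * (x : ℂ) ^ 2)).re :=
    (integral_re h_int).symm
  rw [hre] at h
  simp only [hpt] at h
  rw [h, show (Real.pi / s : ℂ) = ((Real.pi / s : ℝ) : ℂ) by push_cast; rfl,
    show (1 / 2 : ℂ) = ((1 / 2 : ℝ) : ℂ) by push_cast; rfl,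
    ← Complex.ofReal_cpow (by positivity),
    show (-(k : ℂ) ^ 2 / (4 * s)) = ((-k ^ 2 / (4 * s) : ℝ) : ℂ) by push_cast; rfl,
    ← Complex.ofReal_exp, ← Complex.ofReal_mul, Complex.ofReal_re, Real.sqrt_eq_rpow]

theorem integrable_sqrt_mul_exp_neg_mul_add_sq {ε : ℝ} (hε : 0 < ε) :
    Integrable (fun p : ℝ × ℝ => √p.2 * Real.exp (-p.2 * (p.1 ^ 2 + ε ^ 2)))
      (volume.prod (volume.restrict (Ioi 0))) := by
  rw [integrable_prod_iff' (by fun_prop)]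
  have hfac (s x : ℝ) : √s * Real.exp (-s * (x ^ 2 + ε ^ 2)) =
      √s * Real.exp (-s * ε ^ 2) * Real.exp (-s * x ^ 2) := by
    rw [mul_assoc, ← Real.exp_add]; ring_nf
  constructor
  · filter_upwards [ae_restrict_mem measurableSet_Ioi] with s hs
    simp only [hfac]
    exact (integrable_exp_neg_mul_sq hs).const_mul _
  · refine ((exp_neg_integrableOn_Ioi 0 (by positivity : 0 < ε ^ 2)).const_mul √Real.pi).congr ?_
    filter_upwards [ae_restrict_mem measurableSet_Ioi] with s hs
    have hs' : 0 < s := hs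
    have hnn (x : ℝ) : ‖√s * Real.exp (-s * (x ^ 2 + ε ^ 2))‖ =
        √s * Real.exp (-s * ε ^ 2) * Real.exp (-s * x ^ 2) := by
      rw [Real.norm_of_nonneg (by positivity), hfac]
    simp only [hnn]
    rw [integral_const_mul, integral_gaussian, Real.sqrt_div' _ hs'.le,
      show -ε ^ 2 * s = -s * ε ^ 2 by ring]
    have := (Real.sqrt_pos.2 hs').ne'
    field_simp

theorem integral_sqrt_mul_exp_neg_mul {a : ℝ} (ha : 0 < a) :
    ∫ s in Ioi (0 : ℝ), √s * Real.exp (-s * a) = √Real.pi / 2 / a ^ ((3 : ℝ) / 2) := by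
  have h := Real.integral_rpow_mul_exp_neg_mul_Ioi (by norm_num : (0 : ℝ) < 3 / 2) ha
  have hG : Real.Gamma (3 / 2) = √Real.pi / 2 := by
    rw [show (3 / 2 : ℝ) = 1 / 2 + 1 by norm_num, Real.Gamma_add_one (by norm_num),
      Real.Gamma_one_half_eq]
    ring
  rw [hG, one_div, Real.inv_rpow ha.le] at h
  rw [div_eq_inv_mul, ← h]
  refine setIntegral_congr_fun measurableSet_Ioi fun s _ => ?_
  simp only [Real.sqrt_eq_rpow]
  norm_num [mul_comm]

theorem integral_cos_mul_sqrt_mul_exp_neg_mul_add_sq (k ε : ℝ) {s : ℝ} (hs : 0 < s) :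
    ∫ x : ℝ, Real.cos (k * x) * (√s * Real.exp (-s * (x ^ 2 + ε ^ 2))) =
      √Real.pi * Real.exp (-s * ε ^ 2 - k ^ 2 / (4 * s)) := by
  have hfac (x : ℝ) : Real.cos (k * x) * (√s * Real.exp (-s * (x ^ 2 + ε ^ 2))) =
      √s * Real.exp (-s * ε ^ 2) * (Real.cos (k * x) * Real.exp (-s * x ^ 2)) := by
    rw [show -s * (x ^ 2 + ε ^ 2) = -s * ε ^ 2 + -s * x ^ 2 by ring, Real.exp_add]; ring
  have hsqrt : √s * √(Real.pi / s) = √Real.pi := by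
    rw [← Real.sqrt_mul hs.le, mul_div_cancel₀ _ hs.ne']
  simp only [hfac]
  rw [integral_const_mul, integral_cos_mul_exp_neg_mul_sq k hs,
    show -s * ε ^ 2 - k ^ 2 / (4 * s) = -s * ε ^ 2 + -k ^ 2 / (4 * s) by ring, Real.exp_add,
    ← hsqrt]
  ring

theorem integrable_cos_mul_sqrt_mul_exp_neg_mul_add_sq (k : ℝ) {ε : ℝ} (hε : 0 < ε) :
    Integrable (fun p : ℝ × ℝ =>
      Real.cos (k * p.1) * (√p.2 * Real.exp (-p.2 * (p.1 ^ 2 + ε ^ 2))))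
      (volume.prod (volume.restrict (Ioi 0))) :=
  (integrable_sqrt_mul_exp_neg_mul_add_sq hε).bdd_mul
    (f := fun p : ℝ × ℝ => Real.cos (k * p.1)) (c := 1) (by fun_prop) (Filter.Eventually.of_forall fun p => by
      rw [Real.norm_eq_abs]; exact Real.abs_cos_le_one _)

theorem integral_cos_div_rpow_eq_integral_exp (k : ℝ) {ε : ℝ} (hε : 0 < ε) :
    ∫ x : ℝ, Real.cos (k * x) / (x ^ 2 + ε ^ 2) ^ ((3 : ℝ) / 2) =
      2 * ∫ s in Ioi (0 : ℝ), Real.exp (-s * ε ^ 2 - k ^ 2 / (4 * s)) := by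
  have hpi : √Real.pi / 2 ≠ 0 := by positivity
  have hleft (x : ℝ) : ∫ s in Ioi (0 : ℝ),
      Real.cos (k * x) * (√s * Real.exp (-s * (x ^ 2 + ε ^ 2))) =
      √Real.pi / 2 * (Real.cos (k * x) / (x ^ 2 + ε ^ 2) ^ ((3 : ℝ) / 2)) := by
    rw [integral_const_mul, integral_sqrt_mul_exp_neg_mul (by positivity)]
    ring
  refine mul_left_cancel₀ hpi ?_
  rw [← integral_const_mul]
  simp only [← hleft]
  rw [integral_integral_swap (integrable_cos_mul_sqrt_mul_exp_neg_mul_add_sq k hε),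
    setIntegral_congr_fun measurableSet_Ioi fun s hs =>
      integral_cos_mul_sqrt_mul_exp_neg_mul_add_sq k ε (mem_Ioi.1 hs), integral_const_mul]
  ring

theorem image_const_mul_exp {c : ℝ} (hc : 0 < c) :
    (fun u => c * Real.exp u) '' univ = Ioi 0 := by
  ext y
  simp only [image_univ, mem_range, mem_Ioi]
  refine ⟨?_, fun hy => ⟨Real.log (y / c), ?_⟩⟩
  · rintro ⟨u, rfl⟩; positivity
  · rw [Real.exp_log (by positivity)]; field_simp

theorem integral_exp_neg_mul_cosh_mul_exp {z : ℝ}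
    (h_int : Integrable fun u => Real.exp (-z * Real.cosh u) * Real.exp u) :
    ∫ u : ℝ, Real.exp (-z * Real.cosh u) * Real.exp u = 2 * K1 z := by
  have hneg := integral_neg_eq_self (fun u => Real.exp (-z * Real.cosh u) * Real.exp u) volume
  have hadd := integral_add h_int h_int.comp_neg
  have habs := integral_comp_abs (f := fun u => Real.exp (-z * Real.cosh u) * Real.cosh u)
  rw [hneg] at hadd
  have hpt (u : ℝ) : Real.exp (-z * Real.cosh u) * Real.exp u +
      Real.exp (-z * Real.cosh (-u)) * Real.exp (-u) =
      2 * (Real.exp (-z * Real.cosh |u|) * Real.cosh |u|) := by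
    rw [Real.cosh_abs, Real.cosh_neg]
    nth_rw 4 [Real.cosh_eq]
    ring
  simp only [hpt] at hadd
  rw [integral_const_mul, habs] at hadd
  rw [K1]
  linarith

theorem integral_exp_neg_sub_div_eq_K1 {ε k : ℝ} (hε : 0 < ε) (hk : k ≠ 0) :
    ∫ s in Ioi (0 : ℝ), Real.exp (-s * ε ^ 2 - k ^ 2 / (4 * s)) = |k| / ε * K1 (ε * |k|) := by
  have hk' : 0 < |k| := abs_pos.2 hk
  set g : ℝ → ℝ := fun s => Real.exp (-s * ε ^ 2 - k ^ 2 / (4 * s)) with hg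
  have hc : 0 < |k| / (2 * ε) := by positivity
  have hderiv : ∀ u ∈ (univ : Set ℝ), HasDerivWithinAt (fun u => |k| / (2 * ε) * Real.exp u)
      (|k| / (2 * ε) * Real.exp u) univ u := fun u _ =>
    ((Real.hasDerivAt_exp u).const_mul _).hasDerivWithinAt
  have hinj : InjOn (fun u => |k| / (2 * ε) * Real.exp u) univ := fun u _ v _ h =>
    Real.exp_injective (mul_left_cancel₀ hc.ne' h)
  have hpt (u : ℝ) : |(|k| / (2 * ε) * Real.exp u)| • g (|k| / (2 * ε) * Real.exp u) =
      |k| / (2 * ε) * (Real.exp (-(ε * |k|) * Real.cosh u) * Real.exp u) := by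
    have harg : -(|k| / (2 * ε) * Real.exp u) * ε ^ 2 -
        k ^ 2 / (4 * (|k| / (2 * ε) * Real.exp u)) = -(ε * |k|) * Real.cosh u := by
      rw [← sq_abs k, Real.cosh_eq, Real.exp_neg]
      field_simp
      ring
    rw [abs_of_pos (by positivity), smul_eq_mul]
    simp only [hg]
    rw [harg]
    ring
  have hg_int : IntegrableOn g (Ioi 0) := by
    refine Integrable.mono' (exp_neg_integrableOn_Ioi 0 (by positivity : 0 < ε ^ 2))
      (by fun_prop) ?_
    filter_upwards [ae_restrict_mem measurableSet_Ioi] with s hs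
    have hs' : 0 < s := hs
    rw [Real.norm_of_nonneg (Real.exp_pos _).le]
    have : 0 ≤ k ^ 2 / (4 * s) := by positivity
    exact Real.exp_le_exp.2 (by linarith)
  rw [← image_const_mul_exp hc, integrableOn_image_iff_integrableOn_abs_deriv_smul
    MeasurableSet.univ hderiv hinj, integrableOn_univ] at hg_int
  simp only [hpt] at hg_int
  rw [integrable_const_mul_iff hc.ne'.isUnit] at hg_int
  change ∫ s in Ioi (0 : ℝ), g s = _
  rw [← image_const_mul_exp hc, integral_image_eq_integral_abs_deriv_smul
    MeasurableSet.univ hderiv hinj, setIntegral_univ]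
  simp only [hpt]
  rw [integral_const_mul, integral_exp_neg_mul_cosh_mul_exp hg_int]
  ring

theorem cos_integral_K1 (ε k : ℝ) (hε : 0 < ε) (hk : k ≠ 0) :
    ∫ x : ℝ, Real.cos (k*x) / (x^2 + ε^2)^((3:ℝ)/2) = (2*|k|/ε) * K1 (ε * |k|) := by
  rw [integral_cos_div_rpow_eq_integral_exp k hε, integral_exp_neg_sub_div_eq_K1 hε hk]
  ring
end

section
/- For every ε > 0 and every real k ≠ 0, ∫_{−∞}^{∞} (2x⁴ + 2ε²x² + (3/2)ε⁴)/(x² + ε²)^{5/2} · cos(kx) dx = (4 + ε²k²)·K₀(ε|k|) − 2ε|k|·K₁(ε|k|). (This gives the tangential-direction eigenvalue −(1/8π) times this quantity for the straight periodic slender body operator.) -/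
open Filter

open MeasureTheory Set

namespace BesselIntegral

lemma integral_Ioi_sqrt_mul_exp_neg_mul {s : ℝ} (hs : 0 < s) :
    ∫ t in Ioi (0 : ℝ), √t * Real.exp (-(s * t)) = √Real.pi / 2 * (√s ^ 3)⁻¹ := by
  have h := Real.integral_rpow_mul_exp_neg_mul_Ioi (a := 3 / 2) (by norm_num) hs
  have hΓ : Real.Gamma (3 / 2) = √Real.pi / 2 := by
    rw [show (3 / 2 : ℝ) = 1 / 2 + 1 by norm_num, Real.Gamma_add_one (by norm_num),
      Real.Gamma_one_half_eq]
    ring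
  have hpow : (1 / s) ^ (3 / 2 : ℝ) = (√s ^ 3)⁻¹ := by
    rw [one_div, Real.inv_rpow hs.le, Real.sqrt_eq_rpow, ← Real.rpow_natCast, ← Real.rpow_mul hs.le]
    norm_num
  rw [hΓ, hpow, mul_comm] at h
  rw [← h]
  refine setIntegral_congr_fun measurableSet_Ioi fun t _ => ?_
  simp only [Real.sqrt_eq_rpow]
  norm_num

lemma integral_cos_mul_exp_neg_mul_sq {t : ℝ} (ht : 0 < t) (k : ℝ) :
    ∫ x : ℝ, Real.cos (k * x) * Real.exp (-(t * x ^ 2)) =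
      √(Real.pi / t) * Real.exp (-(k ^ 2 / (4 * t))) := by
  have hre : 0 < (t : ℂ).re := by simpa using ht
  have h := fourierIntegral_gaussian hre (k : ℂ)
  have hint : Integrable fun x : ℝ => Complex.exp (Complex.I * k * x) * Complex.exp (-t * x ^ 2) := by
    convert integrable_cexp_quadratic hre (Complex.I * k) 0 using 2 with x
    rw [← Complex.exp_add]
    ring_nf
  have h2 := congrArg Complex.re h
  rw [← RCLike.re_eq_complex_re, ← integral_re hint] at h2
  have hroot : ((Real.pi : ℂ) / t) ^ (1 / 2 : ℂ) = ((√(Real.pi / t) : ℝ) : ℂ) := by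
    rw [Real.sqrt_eq_rpow, Complex.ofReal_cpow (by positivity)]
    push_cast
    rfl
  have hexp : Complex.exp (-(k : ℂ) ^ 2 / (4 * t)) = (Real.exp (-(k ^ 2 / (4 * t))) : ℝ) := by
    push_cast
    congr 1
    ring
  rw [hroot, hexp, ← Complex.ofReal_mul, RCLike.re_eq_complex_re, Complex.ofReal_re] at h2
  rw [← h2]
  refine integral_congr_ae (ae_of_all _ fun x => ?_)
  have h1 : Complex.exp (-(t : ℂ) * x ^ 2) = (Real.exp (-(t * x ^ 2)) : ℝ) := by
    push_cast
    ring_nf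
  have h3 : Complex.exp (Complex.I * k * x) = Complex.exp ((k * x : ℝ) * Complex.I) := by
    push_cast
    ring_nf
  simp only
  rw [h1, h3, Complex.re_mul_ofReal, Complex.exp_ofReal_mul_I_re]

lemma integral_mul_sin_mul_exp_neg_mul_sq {t : ℝ} (ht : 0 < t) (k : ℝ) :
    ∫ x : ℝ, x * Real.sin (k * x) * Real.exp (-(t * x ^ 2)) =
      k / (2 * t) * (√(Real.pi / t) * Real.exp (-(k ^ 2 / (4 * t)))) := by
  have hexp : Integrable fun x : ℝ => Real.exp (-(t * x ^ 2)) := by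
    simpa only [neg_mul] using integrable_exp_neg_mul_sq ht
  have hmul : Integrable fun x : ℝ => x * Real.exp (-(t * x ^ 2)) := by
    simpa only [neg_mul] using integrable_mul_exp_neg_mul_sq ht
  have hcos : Integrable fun x : ℝ => Real.cos (k * x) * Real.exp (-(t * x ^ 2)) :=
    hexp.bdd_mul (c := 1) (by fun_prop) (ae_of_all _ fun x => Real.abs_cos_le_one _)
  have hsin : Integrable fun x : ℝ => Real.sin (k * x) * Real.exp (-(t * x ^ 2)) :=
    hexp.bdd_mul (c := 1) (by fun_prop) (ae_of_all _ fun x => Real.abs_sin_le_one _)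
  have hxsin : Integrable fun x : ℝ => x * Real.sin (k * x) * Real.exp (-(t * x ^ 2)) := by
    refine (hmul.bdd_mul (c := 1) (f := fun x => Real.sin (k * x)) (by fun_prop)
      (ae_of_all _ fun x => Real.abs_sin_le_one _)).congr (ae_of_all _ fun x => ?_)
    simp only
    ring
  have hder : ∀ x : ℝ, HasDerivAt (fun x : ℝ => Real.sin (k * x) * Real.exp (-(t * x ^ 2)))
      (k * (Real.cos (k * x) * Real.exp (-(t * x ^ 2))) -
        2 * t * (x * Real.sin (k * x) * Real.exp (-(t * x ^ 2)))) x := by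
    intro x
    have h1 : HasDerivAt (fun x : ℝ => Real.sin (k * x)) (Real.cos (k * x) * k) x := by
      simpa using ((hasDerivAt_id x).const_mul k).sin
    have h2 : HasDerivAt (fun x : ℝ => Real.exp (-(t * x ^ 2)))
        (Real.exp (-(t * x ^ 2)) * -(t * (2 * x))) x := by
      simpa using (((hasDerivAt_pow 2 x).const_mul t).neg).exp
    refine (h1.mul h2).congr_deriv ?_
    ring
  have h := integral_eq_zero_of_hasDerivAt_of_integrable hder
    ((hcos.const_mul k).sub (hxsin.const_mul (2 * t))) hsin
  rw [integral_sub (hcos.const_mul k) (hxsin.const_mul (2 * t)), integral_const_mul,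
    integral_const_mul, integral_cos_mul_exp_neg_mul_sq ht, sub_eq_zero] at h
  rw [div_mul_eq_mul_div, h, mul_div_cancel_left₀ _ (by positivity)]

lemma integrable_inv_sq_add_sq {ε : ℝ} (hε : 0 < ε) :
    Integrable fun x : ℝ => (x ^ 2 + ε ^ 2)⁻¹ := by
  refine ((integrable_inv_one_add_sq.comp_div hε.ne').const_mul (ε ^ 2)⁻¹).congr
    (ae_of_all _ fun x => ?_)
  simp only
  field_simp
  ring

/-- Subordination of `(x ^ 2 + ε ^ 2) ^ (-3 / 2)` to Gaussians. -/
lemma integral_mul_inv_sqrt_pow_three {ε : ℝ} (hε : 0 < ε) {φ : ℝ → ℝ} (hφ : Measurable φ)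
    (hint : Integrable fun x => φ x * (√(x ^ 2 + ε ^ 2) ^ 3)⁻¹) :
    ∫ x, φ x * (√(x ^ 2 + ε ^ 2) ^ 3)⁻¹ = 2 / √Real.pi * ∫ t in Ioi (0 : ℝ),
      √t * Real.exp (-(ε ^ 2 * t)) * ∫ x, φ x * Real.exp (-(t * x ^ 2)) := by
  have hpos : ∀ x : ℝ, 0 < x ^ 2 + ε ^ 2 := fun x => by positivity
  have hpi : 0 < √Real.pi := Real.sqrt_pos.2 Real.pi_pos
  have hprod : Integrable (Function.uncurry fun x t : ℝ =>
      φ x * (√t * Real.exp (-((x ^ 2 + ε ^ 2) * t)))) (volume.prod (volume.restrict (Ioi 0))) := by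
    refine (integrable_prod_iff ?_).2 ⟨ae_of_all _ fun x => ?_, ?_⟩
    · refine Measurable.aestronglyMeasurable ?_
      unfold Function.uncurry
      fun_prop
    · refine Integrable.const_mul (.of_integral_ne_zero ?_) (φ x)
      rw [integral_Ioi_sqrt_mul_exp_neg_mul (hpos x)]
      have := Real.sqrt_pos.2 (hpos x)
      positivity
    · refine (hint.norm.const_mul (√Real.pi / 2)).congr (ae_of_all _ fun x => ?_)
      simp only [Function.uncurry, norm_mul, Real.norm_eq_abs, Real.abs_exp,
        abs_of_nonneg (Real.sqrt_nonneg _)]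
      rw [integral_const_mul, integral_Ioi_sqrt_mul_exp_neg_mul (hpos x),
        abs_of_nonneg (by positivity : 0 ≤ (√(x ^ 2 + ε ^ 2) ^ 3)⁻¹)]
      ring
  have hswap := integral_integral_swap hprod
  simp_rw [integral_const_mul, integral_Ioi_sqrt_mul_exp_neg_mul (hpos _)] at hswap
  have hleft : ∫ x, φ x * (√(x ^ 2 + ε ^ 2) ^ 3)⁻¹ =
      2 / √Real.pi * ∫ x, φ x * (√Real.pi / 2 * (√(x ^ 2 + ε ^ 2) ^ 3)⁻¹) := by
    rw [← integral_const_mul]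
    refine integral_congr_ae (ae_of_all _ fun x => ?_)
    simp only
    field_simp
  rw [hleft, hswap]
  congr 1
  refine setIntegral_congr_fun measurableSet_Ioi fun t _ => ?_
  rw [← integral_const_mul]
  refine integral_congr_ae (ae_of_all _ fun x => ?_)
  simp only
  rw [show -((x ^ 2 + ε ^ 2) * t) = -(ε ^ 2 * t) + -(t * x ^ 2) by ring, Real.exp_add]
  ring

lemma image_const_mul_exp {c : ℝ} (hc : 0 < c) : (fun u => c * Real.exp u) '' univ = Ioi 0 := by
  ext t
  simp only [image_univ, mem_range, mem_Ioi]
  refine ⟨?_, fun ht => ⟨Real.log (t / c), ?_⟩⟩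
  · rintro ⟨u, rfl⟩
    positivity
  · rw [Real.exp_log (by positivity)]
    field_simp

lemma injective_const_mul_exp {c : ℝ} (hc : 0 < c) :
    Function.Injective fun u => c * Real.exp u :=
  (mul_right_injective₀ hc.ne').comp Real.exp_injective

lemma integral_Ioi_eq_integral_const_mul_exp {c : ℝ} (hc : 0 < c) (g : ℝ → ℝ) :
    ∫ t in Ioi (0 : ℝ), g t = ∫ u, c * Real.exp u * g (c * Real.exp u) := by
  have h := integral_image_eq_integral_abs_deriv_smul (f := fun u => c * Real.exp u)
    MeasurableSet.univ (fun u _ => ((Real.hasDerivAt_exp u).const_mul c).hasDerivWithinAt)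
    (injective_const_mul_exp hc).injOn g
  rw [image_const_mul_exp hc, setIntegral_univ] at h
  simpa only [abs_of_pos (mul_pos hc (Real.exp_pos _)), smul_eq_mul] using h

lemma integrable_const_mul_exp_of_integrableOn_Ioi {c : ℝ} (hc : 0 < c) {g : ℝ → ℝ}
    (hg : IntegrableOn g (Ioi 0)) :
    Integrable fun u => c * Real.exp u * g (c * Real.exp u) := by
  have h := integrableOn_image_iff_integrableOn_abs_deriv_smul (f := fun u => c * Real.exp u)
    MeasurableSet.univ (fun u _ => ((Real.hasDerivAt_exp u).const_mul c).hasDerivWithinAt)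
    (injective_const_mul_exp hc).injOn g
  rw [image_const_mul_exp hc, integrableOn_univ] at h
  simpa only [abs_of_pos (mul_pos hc (Real.exp_pos _)), smul_eq_mul] using h.1 hg

lemma integral_exp_neg_mul_cosh (z : ℝ) : ∫ u, Real.exp (-z * Real.cosh u) = 2 * K0 z := by
  simpa only [Real.cosh_abs, K0] using integral_comp_abs (f := fun u => Real.exp (-z * Real.cosh u))

lemma integral_exp_neg_mul_cosh_mul_cosh (z : ℝ) :
    ∫ u, Real.exp (-z * Real.cosh u) * Real.cosh u = 2 * K1 z := by
  simpa only [Real.cosh_abs, K1] using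
    integral_comp_abs (f := fun u => Real.exp (-z * Real.cosh u) * Real.cosh u)

lemma exponent_const_mul_exp {ε k : ℝ} (hε : 0 < ε) (hk : 0 < k) (u : ℝ) :
    Real.exp (-(ε ^ 2 * (k / (2 * ε) * Real.exp u))) *
      Real.exp (-(k ^ 2 / (4 * (k / (2 * ε) * Real.exp u)))) =
      Real.exp (-(ε * k) * Real.cosh u) := by
  rw [← Real.exp_add, Real.cosh_eq, Real.exp_neg]
  congr 1
  field_simp
  ring

lemma integral_exp_mul_exp_neg_mul_cosh {z : ℝ}
    (h : Integrable fun u => Real.exp u * Real.exp (-z * Real.cosh u)) :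
    ∫ u, Real.exp u * Real.exp (-z * Real.cosh u) = 2 * K1 z := by
  have hneg : Integrable fun u => Real.exp (-u) * Real.exp (-z * Real.cosh u) := by
    simpa only [Real.cosh_neg] using h.comp_neg
  have heq : ∫ u, Real.exp (-u) * Real.exp (-z * Real.cosh u) =
      ∫ u, Real.exp u * Real.exp (-z * Real.cosh u) := by
    simpa only [Real.cosh_neg] using
      integral_neg_eq_self (fun u => Real.exp u * Real.exp (-z * Real.cosh u)) volume
  have hsum : ∫ u, Real.exp (-z * Real.cosh u) * Real.cosh u =
      ((∫ u, Real.exp u * Real.exp (-z * Real.cosh u)) +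
        ∫ u, Real.exp (-u) * Real.exp (-z * Real.cosh u)) / 2 := by
    rw [← integral_add h hneg, ← integral_div]
    refine integral_congr_ae (ae_of_all _ fun u => ?_)
    simp only [Real.cosh_eq u]
    ring
  rw [← integral_exp_neg_mul_cosh_mul_cosh, hsum, heq]
  ring

lemma integral_Ioi_inv_mul_exp_neg {ε k : ℝ} (hε : 0 < ε) (hk : 0 < k) :
    ∫ t in Ioi (0 : ℝ), t⁻¹ * (Real.exp (-(ε ^ 2 * t)) * Real.exp (-(k ^ 2 / (4 * t)))) =
      2 * K0 (ε * k) := by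
  have hc : 0 < k / (2 * ε) := by positivity
  rw [integral_Ioi_eq_integral_const_mul_exp hc, ← integral_exp_neg_mul_cosh]
  refine integral_congr_ae (ae_of_all _ fun u => ?_)
  simp only
  rw [exponent_const_mul_exp hε hk, mul_inv_cancel_left₀ (by positivity)]

lemma integral_Ioi_exp_neg {ε k : ℝ} (hε : 0 < ε) (hk : 0 < k) :
    ∫ t in Ioi (0 : ℝ), Real.exp (-(ε ^ 2 * t)) * Real.exp (-(k ^ 2 / (4 * t))) =
      k / ε * K1 (ε * k) := by
  have hc : 0 < k / (2 * ε) := by positivity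
  have hg : IntegrableOn
      (fun t => Real.exp (-(ε ^ 2 * t)) * Real.exp (-(k ^ 2 / (4 * t)))) (Ioi 0) := by
    have hexp : IntegrableOn (fun t => Real.exp (-(ε ^ 2 * t))) (Ioi 0) := by
      simpa only [neg_mul] using exp_neg_integrableOn_Ioi 0 (by positivity : 0 < ε ^ 2)
    refine Integrable.mul_bdd (c := 1) hexp
      (Measurable.aestronglyMeasurable (by fun_prop)) ?_
    refine (ae_restrict_iff' measurableSet_Ioi).2 (ae_of_all _ fun t (ht : 0 < t) => ?_)
    rw [Real.norm_eq_abs, Real.abs_exp, Real.exp_le_one_iff]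
    have : 0 ≤ k ^ 2 / (4 * t) := by positivity
    linarith
  have hint := integrable_const_mul_exp_of_integrableOn_Ioi hc hg
  rw [integral_Ioi_eq_integral_const_mul_exp hc]
  simp only [exponent_const_mul_exp hε hk, mul_assoc] at hint ⊢
  rw [integral_const_mul, integral_exp_mul_exp_neg_mul_cosh
    ((integrable_const_mul_iff hc.ne'.isUnit _).1 hint)]
  field_simp

lemma sqrt_mul_sqrt_pi_div {t : ℝ} (ht : 0 < t) : √t * √(Real.pi / t) = √Real.pi := by
  rw [← Real.sqrt_mul ht.le, mul_div_cancel₀ _ ht.ne']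

lemma integrable_cos_mul_inv_sqrt_pow_three {ε : ℝ} (hε : 0 < ε) (k : ℝ) :
    Integrable fun x : ℝ => Real.cos (k * x) * (√(x ^ 2 + ε ^ 2) ^ 3)⁻¹ := by
  refine ((integrable_inv_sq_add_sq hε).const_mul ε⁻¹).mono'
    (Measurable.aestronglyMeasurable (by fun_prop)) (ae_of_all _ fun x => ?_)
  have hr : ε ≤ √(x ^ 2 + ε ^ 2) := Real.le_sqrt_of_sq_le (by nlinarith [sq_nonneg x])
  have hr2 : √(x ^ 2 + ε ^ 2) ^ 2 = x ^ 2 + ε ^ 2 := Real.sq_sqrt (by positivity)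
  rw [norm_mul, Real.norm_eq_abs, Real.norm_of_nonneg (by positivity)]
  generalize √(x ^ 2 + ε ^ 2) = r at hr hr2
  rw [← hr2, pow_succ' _ 2, mul_inv]
  calc |Real.cos (k * x)| * (r⁻¹ * (r ^ 2)⁻¹) ≤ 1 * (ε⁻¹ * (r ^ 2)⁻¹) := by
        have hr0 := hε.trans_le hr
        gcongr
        exact Real.abs_cos_le_one _
    _ = _ := one_mul _

lemma integrable_mul_sin_mul_inv_sqrt_pow_three {ε : ℝ} (hε : 0 < ε) (k : ℝ) :
    Integrable fun x : ℝ => x * Real.sin (k * x) * (√(x ^ 2 + ε ^ 2) ^ 3)⁻¹ := by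
  refine (integrable_inv_sq_add_sq hε).mono'
    (Measurable.aestronglyMeasurable (by fun_prop)) (ae_of_all _ fun x => ?_)
  have hr : |x| ≤ √(x ^ 2 + ε ^ 2) := Real.abs_le_sqrt (by nlinarith [sq_nonneg ε])
  have hr0 : 0 < √(x ^ 2 + ε ^ 2) := Real.sqrt_pos.2 (by positivity)
  have hr2 : √(x ^ 2 + ε ^ 2) ^ 2 = x ^ 2 + ε ^ 2 := Real.sq_sqrt (by positivity)
  rw [norm_mul, norm_mul, Real.norm_eq_abs, Real.norm_eq_abs, Real.norm_of_nonneg (by positivity)]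
  generalize √(x ^ 2 + ε ^ 2) = r at hr hr0 hr2
  rw [← hr2]
  calc |x| * |Real.sin (k * x)| * (r ^ 3)⁻¹ ≤ r * 1 * (r ^ 3)⁻¹ := by
        gcongr
        exact Real.abs_sin_le_one _
    _ = (r ^ 2)⁻¹ := by field_simp

lemma integral_cos_mul_inv_sqrt_pow_three {ε k : ℝ} (hε : 0 < ε) (hk : 0 < k) :
    ∫ x : ℝ, Real.cos (k * x) * (√(x ^ 2 + ε ^ 2) ^ 3)⁻¹ = 2 * k / ε * K1 (ε * k) := by
  have hpi : √Real.pi ≠ 0 := (Real.sqrt_pos.2 Real.pi_pos).ne'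
  rw [integral_mul_inv_sqrt_pow_three hε (by fun_prop) (integrable_cos_mul_inv_sqrt_pow_three hε k)]
  have h : ∫ t in Ioi (0 : ℝ), √t * Real.exp (-(ε ^ 2 * t)) *
      ∫ x, Real.cos (k * x) * Real.exp (-(t * x ^ 2)) = ∫ t in Ioi (0 : ℝ),
        √Real.pi * (Real.exp (-(ε ^ 2 * t)) * Real.exp (-(k ^ 2 / (4 * t)))) := by
    refine setIntegral_congr_fun measurableSet_Ioi fun t (ht : 0 < t) => ?_
    rw [integral_cos_mul_exp_neg_mul_sq ht, ← sqrt_mul_sqrt_pi_div ht]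
    ring
  rw [h, integral_const_mul, integral_Ioi_exp_neg hε hk]
  field_simp

lemma integral_mul_sin_mul_inv_sqrt_pow_three {ε k : ℝ} (hε : 0 < ε) (hk : 0 < k) :
    ∫ x : ℝ, x * Real.sin (k * x) * (√(x ^ 2 + ε ^ 2) ^ 3)⁻¹ = 2 * k * K0 (ε * k) := by
  have hpi : √Real.pi ≠ 0 := (Real.sqrt_pos.2 Real.pi_pos).ne'
  rw [integral_mul_inv_sqrt_pow_three hε (by fun_prop)
    (integrable_mul_sin_mul_inv_sqrt_pow_three hε k)]
  have h : ∫ t in Ioi (0 : ℝ), √t * Real.exp (-(ε ^ 2 * t)) *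
      ∫ x, x * Real.sin (k * x) * Real.exp (-(t * x ^ 2)) = ∫ t in Ioi (0 : ℝ),
        √Real.pi * k / 2 *
          (t⁻¹ * (Real.exp (-(ε ^ 2 * t)) * Real.exp (-(k ^ 2 / (4 * t))))) := by
    refine setIntegral_congr_fun measurableSet_Ioi fun t (ht : 0 < t) => ?_
    rw [integral_mul_sin_mul_exp_neg_mul_sq ht, ← sqrt_mul_sqrt_pi_div ht]
    field_simp
  rw [h, integral_const_mul, integral_Ioi_inv_mul_exp_neg hε hk]
  field_simp

/-- The boundary term left by integrating the slowly decaying part by parts. -/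
noncomputable def boundaryTerm (ε k x : ℝ) : ℝ :=
  2 / k * (Real.sin (k * x) / √(x ^ 2 + ε ^ 2)) +
    ε ^ 2 / 2 * (x / √(x ^ 2 + ε ^ 2) ^ 3 * Real.cos (k * x))

lemma hasDerivAt_boundaryTerm {ε k : ℝ} (hε : 0 < ε) (hk : 0 < k) (x : ℝ) :
    HasDerivAt (boundaryTerm ε k)
      ((2*x^4 + 2*ε^2*x^2 + (3/2)*ε^4) / (x^2 + ε^2)^((5:ℝ)/2) * Real.cos (k*x) -
        ((2 / k + ε ^ 2 * k / 2) * (x * Real.sin (k * x) * (√(x ^ 2 + ε ^ 2) ^ 3)⁻¹) -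
          ε ^ 2 * (Real.cos (k * x) * (√(x ^ 2 + ε ^ 2) ^ 3)⁻¹))) x := by
  have hs : 0 < x ^ 2 + ε ^ 2 := by positivity
  have hpow : (x ^ 2 + ε ^ 2) ^ ((5 : ℝ) / 2) = √(x ^ 2 + ε ^ 2) ^ 5 := by
    rw [Real.sqrt_eq_rpow, ← Real.rpow_mul_natCast hs.le]
    norm_num
  have hr : HasDerivAt (fun x : ℝ => √(x ^ 2 + ε ^ 2)) (x / √(x ^ 2 + ε ^ 2)) x := by
    convert ((hasDerivAt_pow 2 x).add_const (ε ^ 2)).sqrt hs.ne' using 1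
    field_simp
    norm_num [mul_comm]
  have hr0 : 0 < √(x ^ 2 + ε ^ 2) := Real.sqrt_pos.2 hs
  have hr2 : √(x ^ 2 + ε ^ 2) ^ 2 = x ^ 2 + ε ^ 2 := Real.sq_sqrt hs.le
  have hsin : HasDerivAt (fun x : ℝ => Real.sin (k * x)) (Real.cos (k * x) * k) x := by
    simpa using ((hasDerivAt_id x).const_mul k).sin
  have hcos : HasDerivAt (fun x : ℝ => Real.cos (k * x)) (-Real.sin (k * x) * k) x := by
    simpa using ((hasDerivAt_id x).const_mul k).cos
  have h := ((hsin.div hr hr0.ne').const_mul (2 / k)).add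
    ((((hasDerivAt_id x).div (hr.pow 3) (pow_pos hr0 3).ne').mul hcos).const_mul (ε ^ 2 / 2))
  refine h.congr_deriv ?_
  rw [hpow]
  simp only [id, Pi.pow_apply, Pi.div_apply]
  generalize √(x ^ 2 + ε ^ 2) = r at hr0 hr2
  have hε2 : ε ^ 2 = r ^ 2 - x ^ 2 := by linarith
  rw [show ε ^ 4 = (ε ^ 2) ^ 2 by ring, hε2]
  field_simp
  ring

lemma abs_boundaryTerm_le {ε k x : ℝ} (hε : 0 < ε) (hk : 0 < k) (hx : 0 < |x|) :
    |boundaryTerm ε k x| ≤ (2 / k + ε ^ 2 / 2 * ε⁻¹) * |x|⁻¹ := by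
  have hr : |x| ≤ √(x ^ 2 + ε ^ 2) := Real.abs_le_sqrt (by nlinarith [sq_nonneg ε])
  have hrε : ε ≤ √(x ^ 2 + ε ^ 2) := Real.le_sqrt_of_sq_le (by nlinarith [sq_nonneg x])
  unfold boundaryTerm
  generalize √(x ^ 2 + ε ^ 2) = r at hr hrε
  have hr0 : 0 < r := hx.trans_le hr
  have h1 : |Real.sin (k * x) / r| ≤ |x|⁻¹ := by
    rw [abs_div, abs_of_pos hr0, div_eq_mul_inv]
    calc |Real.sin (k * x)| * r⁻¹ ≤ 1 * |x|⁻¹ := by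
          gcongr
          exact Real.abs_sin_le_one _
      _ = _ := one_mul _
  have h2 : |x / r ^ 3 * Real.cos (k * x)| ≤ ε⁻¹ * |x|⁻¹ := by
    rw [abs_mul, abs_div, abs_of_pos (pow_pos hr0 3), div_eq_mul_inv]
    calc |x| * (r ^ 3)⁻¹ * |Real.cos (k * x)| ≤ r * (r ^ 3)⁻¹ * 1 := by
          gcongr
          exact Real.abs_cos_le_one _
      _ = r⁻¹ * r⁻¹ := by field_simp
      _ ≤ ε⁻¹ * |x|⁻¹ := by gcongr
  refine (abs_add_le _ _).trans ?_
  rw [abs_mul, abs_mul, abs_of_pos (by positivity : 0 < 2 / k),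
    abs_of_pos (by positivity : 0 < ε ^ 2 / 2), add_mul, mul_assoc (ε ^ 2 / 2)]
  gcongr

lemma tendsto_boundaryTerm {ε k : ℝ} (hε : 0 < ε) (hk : 0 < k) {l : Filter ℝ}
    (hl : Tendsto (fun x : ℝ => |x|) l atTop) : Tendsto (boundaryTerm ε k) l (nhds 0) := by
  refine squeeze_zero_norm' (a := fun x => (2 / k + ε ^ 2 / 2 * ε⁻¹) * |x|⁻¹) ?_ ?_
  · filter_upwards [hl.eventually (eventually_gt_atTop 0)] with x hx
    exact abs_boundaryTerm_le hε hk hx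
  · simpa using (tendsto_inv_atTop_zero.comp hl).const_mul (2 / k + ε ^ 2 / 2 * ε⁻¹)

lemma tendsto_integral_of_pos {ε k : ℝ} (hε : 0 < ε) (hk : 0 < k) :
    Tendsto (fun R : ℝ => ∫ x in (-R)..R,
        (2*x^4 + 2*ε^2*x^2 + (3/2)*ε^4) / (x^2 + ε^2)^((5:ℝ)/2) * Real.cos (k*x))
      atTop (nhds ((4 + ε^2*k^2) * K0 (ε * k) - 2*ε*k * K1 (ε * k))) := by
  have hsin := (integrable_mul_sin_mul_inv_sqrt_pow_three hε k).const_mul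
    (2 / k + ε ^ 2 * k / 2)
  have hcos := (integrable_cos_mul_inv_sqrt_pow_three hε k).const_mul (ε ^ 2)
  have hint : Integrable fun x : ℝ =>
      (2 / k + ε ^ 2 * k / 2) * (x * Real.sin (k * x) * (√(x ^ 2 + ε ^ 2) ^ 3)⁻¹) -
        ε ^ 2 * (Real.cos (k * x) * (√(x ^ 2 + ε ^ 2) ^ 3)⁻¹) := hsin.sub hcos
  have hval := integral_sub hsin hcos
  rw [integral_const_mul, integral_const_mul, integral_mul_sin_mul_inv_sqrt_pow_three hε hk,
    integral_cos_mul_inv_sqrt_pow_three hε hk] at hval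
  have hlim := intervalIntegral_tendsto_integral hint tendsto_neg_atTop_atBot tendsto_id
  have hbot := (tendsto_boundaryTerm hε hk tendsto_abs_atBot_atTop).comp tendsto_neg_atTop_atBot
  have htop := tendsto_boundaryTerm hε hk tendsto_abs_atTop_atTop
  have h := (htop.sub hbot).add hlim
  rw [hval] at h
  convert h using 1
  · funext R
    have hcont : Continuous fun x : ℝ =>
        (2*x^4 + 2*ε^2*x^2 + (3/2)*ε^4) / (x^2 + ε^2)^((5:ℝ)/2) * Real.cos (k*x) := by
      have hs : ∀ x : ℝ, x ^ 2 + ε ^ 2 ≠ 0 := fun x => by positivity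
      refine Continuous.mul (Continuous.div (by fun_prop) ?_ fun x => ?_) (by fun_prop)
      · exact Continuous.rpow_const (by fun_prop) fun x => .inl (hs x)
      · positivity
    have hI := hcont.intervalIntegrable (μ := volume) (-R) R
    have hJ := hint.intervalIntegrable (a := -R) (b := R)
    have hFTC := intervalIntegral.integral_eq_sub_of_hasDerivAt
      (fun x _ => hasDerivAt_boundaryTerm hε hk x) (hI.sub hJ)
    simp only [Function.comp_apply, id]
    rw [← hFTC, ← intervalIntegral.integral_add (hI.sub hJ) hJ]
    simp only [sub_add_cancel]
  · congr 1
    field_simp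
    ring

end BesselIntegral

/-- Tangential-direction eigenvalue integral for the straight periodic slender body operator,
as a principal value over the real line. -/
theorem tangential_eigenvalue_integral (ε k : ℝ) (hε : 0 < ε) (hk : k ≠ 0) :
    Tendsto (fun R : ℝ => ∫ x in (-R)..R,
        (2*x^4 + 2*ε^2*x^2 + (3/2)*ε^4) / (x^2 + ε^2)^((5:ℝ)/2) * Real.cos (k*x))
      atTop (nhds ((4 + ε^2*k^2) * K0 (ε * |k|) - 2*ε*|k| * K1 (ε * |k|))) := by
  have hcos : ∀ x : ℝ, Real.cos (|k| * x) = Real.cos (k * x) := fun x => by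
    rcases abs_choice k with h | h <;> simp [h]
  simpa only [hcos, sq_abs] using BesselIntegral.tendsto_integral_of_pos hε (abs_pos.2 hk)
end

section
/- Let L > 0 and η ≥ 1. There exists a constant C > 0 (depending only on L and η) such that for all ε ∈ (0, 1], all r ∈ [0, 1], and all s ∈ [−L, L]: | log( ((L² − s²) + √(L² + ε²r²)) / ((L² − s²) + √(L² + η²ε²r²)) ) | ≤ C·ε². -/
theorem abs_log_div_le_of_le {c p q : ℝ} (hc : 0 < c) (hcp : c ≤ p) (hpq : p ≤ q) :
    |Real.log (p / q)| ≤ (q - p) / c := by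
  have hp : 0 < p := hc.trans_le hcp
  have hq : 0 < q := hp.trans_le hpq
  rw [abs_of_nonpos (Real.log_nonpos (by positivity) ((div_le_one hq).2 hpq)),
    ← Real.log_inv, inv_div]
  calc Real.log (q / p) ≤ q / p - 1 := Real.log_le_sub_one_of_pos (by positivity)
    _ = (q - p) / p := by field_simp
    _ ≤ (q - p) / c := div_le_div_of_nonneg_left (sub_nonneg.2 hpq) hc hcp

theorem sqrt_sub_sqrt_le_div {c x y : ℝ} (hc : 0 < c) (hx : c ^ 2 ≤ x) (hxy : x ≤ y) :
    √y - √x ≤ (y - x) / c := by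
  have hcx : c ≤ √x := Real.le_sqrt_of_sq_le hx
  have hle : √x ≤ √y := Real.sqrt_le_sqrt hxy
  have hx0 : 0 ≤ x := (sq_nonneg c).trans hx
  rw [le_div_iff₀ hc]
  nlinarith [Real.sq_sqrt hx0, Real.sq_sqrt (hx0.trans hxy),
    mul_nonneg (sub_nonneg.2 hle) (by linarith : 0 ≤ √y + √x - c)]

theorem log_ratio_estimate (L η : ℝ) (hL : 0 < L) (hη : 1 ≤ η) :
    ∃ C > 0, ∀ ε ∈ Set.Ioc (0:ℝ) 1, ∀ r ∈ Set.Icc (0:ℝ) 1, ∀ s ∈ Set.Icc (-L) L,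
      |Real.log (((L^2 - s^2) + Real.sqrt (L^2 + ε^2*r^2)) /
          ((L^2 - s^2) + Real.sqrt (L^2 + η^2*ε^2*r^2)))| ≤ C * ε^2 := by
  refine ⟨η ^ 2 / L ^ 2, by positivity, fun ε _ r hr s hs => ?_⟩
  have hs2 : s ^ 2 ≤ L ^ 2 := sq_le_sq' hs.1 hs.2
  have hr2 : r ^ 2 ≤ 1 := pow_le_one₀ hr.1 hr.2
  have hη2 : 1 ≤ η ^ 2 := one_le_pow₀ hη
  have hx : L ^ 2 ≤ L ^ 2 + ε ^ 2 * r ^ 2 := le_add_of_nonneg_right (by positivity)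
  have hxy : L ^ 2 + ε ^ 2 * r ^ 2 ≤ L ^ 2 + η ^ 2 * ε ^ 2 * r ^ 2 := by
    rw [mul_assoc (η ^ 2)]
    exact add_le_add_right (le_mul_of_one_le_left (by positivity) hη2) _
  have hLx := Real.le_sqrt_of_sq_le hx
  have hsqrt := Real.sqrt_le_sqrt hxy
  have hbound : η ^ 2 * ε ^ 2 * r ^ 2 ≤ η ^ 2 * ε ^ 2 :=
    mul_le_of_le_one_right (by positivity) hr2
  have hnonneg : 0 ≤ ε ^ 2 * r ^ 2 := by positivity
  calc _ ≤ _ := abs_log_div_le_of_le hL (by linarith) (by linarith)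
    _ = (√(L ^ 2 + η ^ 2 * ε ^ 2 * r ^ 2) - √(L ^ 2 + ε ^ 2 * r ^ 2)) / L := by ring
    _ ≤ (L ^ 2 + η ^ 2 * ε ^ 2 * r ^ 2 - (L ^ 2 + ε ^ 2 * r ^ 2)) / L / L := by
      gcongr
      exact sqrt_sub_sqrt_le_div hL hx hxy
    _ ≤ η ^ 2 * ε ^ 2 / L / L := by
      gcongr
      linarith
    _ = η ^ 2 / L ^ 2 * ε ^ 2 := by field_simp
end

section
/- For all q > 0 and all ε ∈ (0, q]: | ∫_{−q}^{q} x²/(x² + ε²)^{3/2} dx − (2·log(2q/ε) − 2) | ≤ 2·ε²/q². -/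
lemma rpow_three_halves_eq_sqrt_pow {y : ℝ} (hy : 0 ≤ y) : y ^ ((3:ℝ)/2) = √y ^ 3 := by
  rw [Real.sqrt_eq_rpow, ← Real.rpow_natCast, ← Real.rpow_mul hy]
  norm_num

lemma sqrt_one_add_div_sq {ε : ℝ} (hε : 0 < ε) (x : ℝ) :
    √(1 + (x / ε) ^ 2) = √(x ^ 2 + ε ^ 2) / ε := by
  rw [show 1 + (x / ε) ^ 2 = (x ^ 2 + ε ^ 2) / ε ^ 2 by field_simp; ring,
    Real.sqrt_div (by positivity), Real.sqrt_sq hε.le]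

lemma hasDerivAt_arsinh_sub_div_sqrt {ε : ℝ} (hε : 0 < ε) (x : ℝ) :
    HasDerivAt (fun x => Real.arsinh (x / ε) - x / √(x ^ 2 + ε ^ 2))
      (x ^ 2 / (x ^ 2 + ε ^ 2) ^ ((3:ℝ)/2)) x := by
  have hpos : 0 < x ^ 2 + ε ^ 2 := by positivity
  have hR : 0 < √(x ^ 2 + ε ^ 2) := Real.sqrt_pos.2 hpos
  have hsqrt := (((hasDerivAt_id x).pow 2).add_const (ε ^ 2)).sqrt hpos.ne'
  have hF := ((hasDerivAt_id x).div_const ε).arsinh.sub ((hasDerivAt_id x).div hsqrt hR.ne')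
  refine hF.congr_deriv ?_
  simp only [id, Pi.pow_apply, smul_eq_mul]
  rw [rpow_three_halves_eq_sqrt_pow hpos.le, sqrt_one_add_div_sq hε]
  generalize √(x ^ 2 + ε ^ 2) = R at *
  field_simp
  norm_num
  ring

/-- The tangential Stokeslet integral in closed form. -/
lemma integral_sq_div_rpow_three_halves {ε : ℝ} (hε : 0 < ε) (q : ℝ) :
    ∫ x in (-q)..q, x ^ 2 / (x ^ 2 + ε ^ 2) ^ ((3:ℝ)/2) =
      2 * Real.arsinh (q / ε) - 2 * (q / √(q ^ 2 + ε ^ 2)) := by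
  rw [intervalIntegral.integral_eq_sub_of_hasDerivAt
    (fun x _ => hasDerivAt_arsinh_sub_div_sqrt hε x)]
  · simp only [neg_div, Real.arsinh_neg, neg_sq]
    ring
  · refine Continuous.intervalIntegrable ?_ _ _
    refine (by fun_prop : Continuous fun x : ℝ => x ^ 2).div
      ((by fun_prop : Continuous fun x : ℝ => x ^ 2 + ε ^ 2).rpow_const fun x => Or.inr ?_)
      fun x => ?_
    · norm_num
    · positivity

theorem tangential_stokeslet_local_integral (q ε : ℝ) (hq : 0 < q) (hε : ε ∈ Set.Ioc (0:ℝ) q) :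
    |(∫ x in (-q)..q, x^2 / (x^2 + ε^2)^((3:ℝ)/2)) - (2 * Real.log (2*q/ε) - 2)|
      ≤ 2 * ε^2/q^2 := by
  have hε0 : 0 < ε := hε.1
  rw [integral_sq_div_rpow_three_halves hε0, Real.arsinh, sqrt_one_add_div_sq hε0]
  have hsq : √(q ^ 2 + ε ^ 2) ^ 2 = q ^ 2 + ε ^ 2 := Real.sq_sqrt (by positivity)
  have hqR : q ≤ √(q ^ 2 + ε ^ 2) := Real.le_sqrt_of_sq_le (by nlinarith)
  generalize √(q ^ 2 + ε ^ 2) = R at *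
  have hR : 0 < R := hq.trans_le hqR
  have hlog : Real.log (q / ε + R / ε) - Real.log (2 * q / ε) = Real.log ((q + R) / (2 * q)) := by
    rw [← Real.log_div (by positivity) (by positivity)]
    congr 1
    field_simp
  have hlog_nonneg : 0 ≤ Real.log ((q + R) / (2 * q)) :=
    Real.log_nonneg (by rw [le_div_iff₀ (by positivity)]; linarith)
  have hlog_le := Real.log_le_sub_one_of_pos (show 0 < (q + R) / (2 * q) by positivity)
  have hhalf : (q + R) / (2 * q) - 1 = (R / q - 1) / 2 := by field_simp; ring
  have hdiv_le : q / R ≤ 1 := (div_le_one hR).2 hqR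
  have hone_le : 1 ≤ R / q := (one_le_div hq).2 hqR
  have hmul : q / R * (R / q) = 1 := by field_simp
  have hRq : (R / q) ^ 2 = 1 + ε ^ 2 / q ^ 2 := by rw [div_pow, hsq]; field_simp
  have ht : 0 ≤ ε ^ 2 / q ^ 2 := by positivity
  have hone_sub_le : 1 - q / R ≤ R / q - 1 := by nlinarith
  have hsub_one_le : R / q - 1 ≤ ε ^ 2 / q ^ 2 / 2 := by nlinarith
  rw [mul_div_assoc 2 (ε ^ 2), abs_le]
  constructor <;> linarith
end

section
/- For every ε > 0, setting c = 1/√(ε²π² + 1), the drag integral for a thin ring translating broadwise satisfies ∫_{−1/2}^{1/2} √2·π·(3ε²π² − cos(2πu) + 1) / (2ε²π² − cos(2πu) + 1)^{3/2} du = c·( 2·∫₀¹ dθ/(√(1 − θ²)·√(1 − c²θ²)) + ∫₀¹ √(1 − c²θ²)/√(1 − θ²) dθ ). -/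
open MeasureTheory Set in
/-- The substitution `x = sin t` in an integral with weight `1 / √(1 - x²)`. -/
theorem integral_div_sqrt_one_sub_sq (g : ℝ → ℝ) :
    ∫ x in (0:ℝ)..1, g x / √(1 - x ^ 2) = ∫ t in (0:ℝ)..(Real.pi / 2), g (Real.sin t) := by
  have himg : Real.sin '' Ioo 0 (Real.pi / 2) = Ioo 0 1 := by
    ext x
    constructor
    · rintro ⟨t, ⟨h0, h1⟩, rfl⟩
      refine ⟨Real.sin_pos_of_pos_of_lt_pi h0 (by linarith), ?_⟩
      simpa using Real.sin_lt_sin_of_lt_of_le_pi_div_two (by linarith) le_rfl h1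
    · rintro ⟨h0, h1⟩
      exact ⟨Real.arcsin x, ⟨Real.arcsin_pos.2 h0, Real.arcsin_lt_pi_div_two.2 h1⟩,
        Real.sin_arcsin (by linarith) h1.le⟩
  have hinj : InjOn Real.sin (Ioo 0 (Real.pi / 2)) :=
    Real.injOn_sin.mono
      (Ioo_subset_Icc_self.trans (Icc_subset_Icc_left (by linarith [Real.pi_pos])))
  rw [intervalIntegral.integral_of_le zero_le_one,
    intervalIntegral.integral_of_le Real.pi_div_two_pos.le,
    integral_Ioc_eq_integral_Ioo, integral_Ioc_eq_integral_Ioo, ← himg,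
    integral_image_eq_integral_abs_deriv_smul measurableSet_Ioo
      (fun t _ => (Real.hasDerivAt_sin t).hasDerivWithinAt) hinj]
  refine setIntegral_congr_fun measurableSet_Ioo fun t ht => ?_
  have hcos : 0 < Real.cos t := Real.cos_pos_of_mem_Ioo ⟨by linarith [ht.1, ht.2], ht.2⟩
  have hsqrt : √(1 - Real.sin t ^ 2) = Real.cos t := by
    rw [← Real.cos_sq', Real.sqrt_sq hcos.le]
  simp only [hsqrt, abs_of_pos hcos, smul_eq_mul]
  field_simp

/-- A continuous function symmetric about `π / 2` has twice the integral over `[0, π]` that it has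
over `[0, π / 2]`. -/
theorem integral_zero_pi_eq_two_mul {f : ℝ → ℝ} (hf : Continuous f)
    (hsymm : ∀ t, f (Real.pi - t) = f t) :
    ∫ t in (0:ℝ)..Real.pi, f t = 2 * ∫ t in (0:ℝ)..(Real.pi / 2), f t := by
  have h : ∫ t in (Real.pi / 2)..Real.pi, f t = ∫ t in (0:ℝ)..(Real.pi / 2), f t := by
    have := intervalIntegral.integral_comp_sub_left (a := 0) (b := Real.pi / 2) f Real.pi
    simp only [hsymm, sub_zero, sub_half] at this
    exact this.symm
  rw [← intervalIntegral.integral_add_adjacent_intervals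
    (hf.intervalIntegrable 0 (Real.pi / 2)) (hf.intervalIntegrable _ _), h]
  ring

theorem one_sub_sq_mul_sin_sq_pos {c : ℝ} (hc : c ^ 2 < 1) (t : ℝ) :
    0 < 1 - c ^ 2 * Real.sin t ^ 2 := by
  nlinarith [Real.sin_sq_le_one t, sq_nonneg (Real.sin t), sq_nonneg c]

theorem continuous_sqrt_one_sub_sq_mul_sin_sq (c : ℝ) :
    Continuous fun t => √(1 - c ^ 2 * Real.sin t ^ 2) := by
  fun_prop

theorem hasDerivAt_sin_mul_cos_div_sqrt {c : ℝ} (hc : c ^ 2 < 1) (t : ℝ) :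
    HasDerivAt (fun t => c ^ 2 * (Real.sin t * Real.cos t / √(1 - c ^ 2 * Real.sin t ^ 2)))
      (√(1 - c ^ 2 * Real.sin t ^ 2) - (1 - c ^ 2) / √(1 - c ^ 2 * Real.sin t ^ 2) ^ 3) t := by
  have hpos := one_sub_sq_mul_sin_sq_pos hc t
  have hD : 0 < √(1 - c ^ 2 * Real.sin t ^ 2) := Real.sqrt_pos.2 hpos
  have hDsq := Real.sq_sqrt hpos.le
  have hinner := ((((Real.hasDerivAt_sin t).pow 2).const_mul (c ^ 2)).const_sub 1).sqrt hpos.ne'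
  have h := ((((Real.hasDerivAt_sin t).mul (Real.hasDerivAt_cos t)).div hinner hD.ne').const_mul
    (c ^ 2))
  refine h.congr_deriv ?_
  simp only [Pi.mul_apply, Pi.pow_apply]
  set D := √(1 - c ^ 2 * Real.sin t ^ 2)
  have hcos := Real.cos_sq' t
  set s := Real.sin t
  set k := Real.cos t
  have hD4 : D ^ 4 = (1 - c ^ 2 * s ^ 2) ^ 2 := by rw [← hDsq]; ring
  field_simp
  ring_nf
  simp only [hD4, hDsq, hcos]
  ring

/-- The complete elliptic integral of the third kind with characteristic `c²` reduces to the second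
kind; here over `[0, π]`. -/
theorem integral_div_sqrt_one_sub_sq_mul_sin_sq_pow_three {c : ℝ} (hc : c ^ 2 < 1) :
    ∫ t in (0:ℝ)..Real.pi, (1 - c ^ 2) / √(1 - c ^ 2 * Real.sin t ^ 2) ^ 3 =
      ∫ t in (0:ℝ)..Real.pi, √(1 - c ^ 2 * Real.sin t ^ 2) := by
  have hD (t : ℝ) := (Real.sqrt_pos.2 (one_sub_sq_mul_sin_sq_pos hc t)).ne'
  have hcont := continuous_sqrt_one_sub_sq_mul_sin_sq c
  have hcont' : Continuous fun t => (1 - c ^ 2) / √(1 - c ^ 2 * Real.sin t ^ 2) ^ 3 :=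
    continuous_const.div (hcont.pow 3) fun t => pow_ne_zero 3 (hD t)
  have h := intervalIntegral.integral_eq_sub_of_hasDerivAt (a := 0) (b := Real.pi)
    (fun t _ => hasDerivAt_sin_mul_cos_div_sqrt hc t) ((hcont.sub hcont').intervalIntegrable _ _)
  rw [intervalIntegral.integral_sub (hcont.intervalIntegrable _ _)
    (hcont'.intervalIntegrable _ _)] at h
  simp only [Real.sin_pi, Real.sin_zero, zero_mul, zero_div, mul_zero, sub_self] at h
  linarith

theorem ring_drag_integrand_eq {a c : ℝ} (ha : 0 < a) (hc : c = 1 / √(a + 1)) (t : ℝ) :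
    √2 * Real.pi * (3 * a + Real.cos (2 * t) + 1) / (2 * a + Real.cos (2 * t) + 1) ^ ((3:ℝ) / 2) =
      Real.pi * (c / 2 * (2 * (1 / √(1 - c ^ 2 * Real.sin t ^ 2)) +
        (1 - c ^ 2) / √(1 - c ^ 2 * Real.sin t ^ 2) ^ 3)) := by
  have hcpos : 0 < c := by rw [hc]; positivity
  have hcsq : c ^ 2 * (a + 1) = 1 := by
    rw [hc, div_pow, Real.sq_sqrt (by positivity)]; field_simp
  have hpos := one_sub_sq_mul_sin_sq_pos (c := c) (by nlinarith) t
  have hD : 0 < √(1 - c ^ 2 * Real.sin t ^ 2) := Real.sqrt_pos.2 hpos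
  have hDsq := Real.sq_sqrt hpos.le
  set D := √(1 - c ^ 2 * Real.sin t ^ 2)
  have h2 : √2 ^ 2 = 2 := Real.sq_sqrt zero_le_two
  have haeq : a = (1 - c ^ 2) / c ^ 2 := by field_simp; linarith
  have hbase : 2 * a + Real.cos (2 * t) + 1 = (√2 * D / c) ^ 2 := by
    rw [div_pow, mul_pow, h2, hDsq, haeq, Real.cos_two_mul, Real.cos_sq']
    field_simp
    ring
  have hden : (2 * a + Real.cos (2 * t) + 1) ^ ((3:ℝ) / 2) = (√2 * D / c) ^ 3 := by
    rw [hbase, ← Real.rpow_natCast_mul (by positivity), ← Real.rpow_natCast]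
    norm_num
  have hnum : 3 * a + Real.cos (2 * t) + 1 = (2 * D ^ 2 + (1 - c ^ 2)) / c ^ 2 := by
    rw [show 3 * a + Real.cos (2 * t) + 1 = (2 * a + Real.cos (2 * t) + 1) + a by ring, hbase,
      div_pow, mul_pow, h2, add_div, ← haeq]
  have h3 : √2 ^ 3 = 2 * √2 := by rw [pow_succ, h2]
  rw [hden, hnum, div_pow, mul_pow, h3]
  field_simp

/-- The drag integral for a thin ring translating broadwise, expressed via
complete elliptic integrals of the first and second kind. -/
theorem ring_drag_elliptic (ε : ℝ) (hε : 0 < ε) :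
    let c := 1 / Real.sqrt (ε^2 * Real.pi^2 + 1)
    (∫ u in (-(1:ℝ)/2)..(1/2),
        Real.sqrt 2 * Real.pi * (3*ε^2*Real.pi^2 - Real.cos (2*Real.pi*u) + 1) /
          (2*ε^2*Real.pi^2 - Real.cos (2*Real.pi*u) + 1)^((3:ℝ)/2))
      = c * (2 * (∫ θ in (0:ℝ)..1, 1 / (Real.sqrt (1 - θ^2) * Real.sqrt (1 - c^2*θ^2)))
          + ∫ θ in (0:ℝ)..1, Real.sqrt (1 - c^2*θ^2) / Real.sqrt (1 - θ^2)) := by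
  intro c
  have ha : 0 < ε ^ 2 * Real.pi ^ 2 := by positivity
  have hc : c ^ 2 < 1 := by
    rw [div_pow, Real.sq_sqrt (by positivity), one_pow, div_lt_one (by positivity)]
    linarith
  have hD (t : ℝ) := (Real.sqrt_pos.2 (one_sub_sq_mul_sin_sq_pos hc t)).ne'
  have hcont := continuous_sqrt_one_sub_sq_mul_sin_sq c
  have hcont1 : Continuous fun t => 1 / √(1 - c ^ 2 * Real.sin t ^ 2) :=
    continuous_const.div hcont hD
  have hcont3 : Continuous fun t => (1 - c ^ 2) / √(1 - c ^ 2 * Real.sin t ^ 2) ^ 3 :=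
    continuous_const.div (hcont.pow 3) fun t => pow_ne_zero 3 (hD t)
  have hK : ∫ θ in (0:ℝ)..1, 1 / (√(1 - θ ^ 2) * √(1 - c ^ 2 * θ ^ 2)) =
      ∫ t in (0:ℝ)..(Real.pi / 2), 1 / √(1 - c ^ 2 * Real.sin t ^ 2) := by
    rw [← integral_div_sqrt_one_sub_sq fun x => 1 / √(1 - c ^ 2 * x ^ 2)]
    simp only [div_div, mul_comm]
  have hintegrand (u : ℝ) :
      √2 * Real.pi * (3 * ε ^ 2 * Real.pi ^ 2 - Real.cos (2 * Real.pi * u) + 1) /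
          (2 * ε ^ 2 * Real.pi ^ 2 - Real.cos (2 * Real.pi * u) + 1) ^ ((3:ℝ) / 2) =
        Real.pi * (c / 2 * (2 * (1 / √(1 - c ^ 2 * Real.sin (Real.pi * u + Real.pi / 2) ^ 2)) +
          (1 - c ^ 2) / √(1 - c ^ 2 * Real.sin (Real.pi * u + Real.pi / 2) ^ 2) ^ 3)) := by
    rw [← ring_drag_integrand_eq ha rfl,
      show 2 * (Real.pi * u + Real.pi / 2) = 2 * Real.pi * u + Real.pi by ring, Real.cos_add_pi]
    simp only [mul_assoc, sub_eq_add_neg]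
  simp only [hintegrand]
  rw [intervalIntegral.integral_const_mul, intervalIntegral.mul_integral_comp_mul_add
      (f := fun t => c / 2 * (2 * (1 / √(1 - c ^ 2 * Real.sin t ^ 2)) +
        (1 - c ^ 2) / √(1 - c ^ 2 * Real.sin t ^ 2) ^ 3)),
    show Real.pi * (-1 / 2) + Real.pi / 2 = 0 by ring,
    show Real.pi * (1 / 2) + Real.pi / 2 = Real.pi by ring,
    intervalIntegral.integral_const_mul,
    intervalIntegral.integral_add ((hcont1.const_mul 2).intervalIntegrable _ _)
      (hcont3.intervalIntegrable _ _),
    intervalIntegral.integral_const_mul, integral_div_sqrt_one_sub_sq_mul_sin_sq_pow_three hc,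
    integral_zero_pi_eq_two_mul hcont1 (fun t => by rw [Real.sin_pi_sub]),
    integral_zero_pi_eq_two_mul hcont (fun t => by rw [Real.sin_pi_sub]), hK,
    integral_div_sqrt_one_sub_sq fun x => √(1 - c ^ 2 * x ^ 2)]
  ring
end
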